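/- Let A be an abelian category and U a d-rigid full additive subcategory closed under direct summands. If U is right maximal d-rigid in A (i.e. every object E of A admits an exact sequence 0 → E → U^1 → ⋯ → U^d → 0 with all U^i in U), then U = {E ∈ A : Ext^i_A(U, E) = 0 for all U ∈ U and 0 < i < d}. -/

import Mathlib

open CategoryTheory CategoryTheory.Limits

universe v u

variable (A : Type u) [Category.{v} A] [Abelian A]

/-- An exact sequence `0 → Y → E_n → ⋯ → E_1 → X → 0` with `n` middle terms `E_n, …, E_1`,
encoded as an `ℕ`-indexed complex with `ob 0 ≅ X`, `ob (n+1) ≅ Y`, zero objects in degrees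
above `n+1`, exactness at every position `≥ 1` and an epimorphism at the bottom. -/
structure ExtSeq (n : ℕ) (X Y : A) where
  ob : ℕ → A
  d : ∀ i : ℕ, ob (i + 1) ⟶ ob i
  iso0 : ob 0 ≅ X
  isoTop : ob (n + 1) ≅ Y
  is_zero : ∀ i, n + 1 < i → IsZero (ob i)
  w : ∀ i, d (i + 1) ≫ d i = 0
  ex : ∀ i, (ShortComplex.mk (d (i + 1)) (d i) (w i)).Exact
  epi0 : Epi (d 0)

variable {A}

/-- A morphism of `n`-extensions inducing the identity on the two end terms. -/
structure ExtSeqHom {n : ℕ} {X Y : A} (s t : ExtSeq A n X Y) where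
  φ : ∀ i, s.ob i ⟶ t.ob i
  comm : ∀ i, s.d i ≫ φ i = φ (i + 1) ≫ t.d i
  φ0 : φ 0 = s.iso0.hom ≫ t.iso0.inv
  φTop : φ (n + 1) = s.isoTop.hom ≫ t.isoTop.inv

/-- Yoneda equivalence of `n`-fold extensions: the equivalence relation generated by the
existence of a morphism of extensions fixing the end terms. -/
def YonedaEquiv {n : ℕ} {X Y : A} : ExtSeq A n X Y → ExtSeq A n X Y → Prop :=
  Relation.EqvGen fun s t => Nonempty (ExtSeqHom s t)

variable (A) in
/-- `extVanish A n X Y` expresses the vanishing of the Yoneda Ext-group `Ext^n_A(X, Y)`: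
all `n`-fold extensions of `X` by `Y` are Yoneda equivalent. -/
def extVanish (n : ℕ) (X Y : A) : Prop :=
  ∀ s t : ExtSeq A n X Y, YonedaEquiv s t

variable (A) in
/-- `coresSet 𝒰 j` is the class `𝒰^j(A)` of objects `E` admitting an exact sequence
`0 → E → U^1 → ⋯ → U^j → 0` with all `U^i ∈ 𝒰`. -/
def coresSet (𝒰 : Set A) : ℕ → Set A
  | 0 => {E | IsZero E}
  | j + 1 => {E | ∃ (V : A) (f : E ⟶ V), V ∈ 𝒰 ∧ Mono f ∧ cokernel f ∈ coresSet 𝒰 j}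

variable (A) in
/-- `resSet 𝒰 j` is the class `𝒰_j(A)` of objects `E` admitting an exact sequence
`0 → U_j → ⋯ → U_1 → E → 0` with all `U_i ∈ 𝒰`. -/
def resSet (𝒰 : Set A) : ℕ → Set A
  | 0 => {E | IsZero E}
  | j + 1 => {E | ∃ (V : A) (f : V ⟶ E), V ∈ 𝒰 ∧ Epi f ∧ kernel f ∈ resSet 𝒰 j}

/-- The extension lies (admissibly) in the subcategory `𝒮`: all its terms and all the
images of its differentials (the splice objects) belong to `𝒮`. -/
def ExtSeq.allIn {n : ℕ} {X Y : A} (s : ExtSeq A n X Y) (𝒮 : Set A) : Prop :=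
  (∀ i, i ≤ n + 1 → s.ob i ∈ 𝒮) ∧ ∀ i, 1 ≤ i → i ≤ n → (image (s.d i) : A) ∈ 𝒮

/-- Yoneda equivalence computed inside the subcategory `𝒮`: the equivalence relation
generated by morphisms of extensions between extensions lying in `𝒮`. -/
def YonedaEquivIn (𝒮 : Set A) {n : ℕ} {X Y : A} :
    ExtSeq A n X Y → ExtSeq A n X Y → Prop :=
  Relation.EqvGen fun s t => s.allIn 𝒮 ∧ t.allIn 𝒮 ∧ Nonempty (ExtSeqHom s t)

variable (A) in
/-- `𝒰` is closed under `d`-extensions in `A`. -/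
def DExtClosed (𝒰 : Set A) (d : ℕ) : Prop :=
  ∀ (X Y : A), X ∈ 𝒰 → Y ∈ 𝒰 → ∀ s : ExtSeq A d X Y,
    ∃ t : ExtSeq A d X Y, (∀ i, 1 ≤ i → i ≤ d → t.ob i ∈ 𝒰) ∧ YonedaEquiv s t

section Efface
open HomologicalComplex DerivedCategory

theorem aux_epi_p {C : Type u} [Category.{v} C] [Abelian C] {X : C} {K : CochainComplex C ℤ}
    (π : K ⟶ (HomologicalComplex.single C (ComplexShape.up ℤ) 0).obj X) [K.IsStrictlyLE 0]
    [QuasiIsoAt π 0] : Epi (π.f 0 ≫ (singleObjXSelf (ComplexShape.up ℤ) 0 X).hom) := by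
  let e := K.iCyclesIso 0 (0 + 1) (by simp)
    ((K.isZero_of_isStrictlyLE 0 (0 + 1) (by simp)).eq_of_tgt _ _)
  have : π.f 0 ≫ (singleObjXSelf (ComplexShape.up ℤ) 0 X).hom = e.inv ≫ K.homologyπ 0 ≫ homologyMap π 0 ≫ (singleObjHomologySelfIso _ _ _).hom := by
    rw [← cancel_epi e.hom]
    dsimp only [e]
    rw [Iso.hom_inv_id_assoc, homologyπ_naturality_assoc,
      homologyπ_singleObjHomologySelfIso_hom, iCyclesIso_hom, ← cyclesMap_i_assoc]
    congr 1
  rw [this]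
  infer_instance

theorem aux_efface_Q {C : Type u} [Category.{v} C] [Abelian C] [HasDerivedCategory.{max u v} C] {X : C}
    {L : CochainComplex C ℤ}
    (φ : Q.obj ((HomologicalComplex.single C (ComplexShape.up ℤ) 0).obj X) ⟶ Q.obj L)
    (n : ℤ) (hn : n < 0) [L.IsStrictlyLE n] :
    ∃ (P : C) (p : P ⟶ X), Epi p ∧
      Q.map ((HomologicalComplex.single C (ComplexShape.up ℤ) 0).map p) ≫ φ = 0 := by
  have : CochainComplex.IsStrictlyLE ((HomologicalComplex.single C (ComplexShape.up ℤ) 0).obj X) 0 :=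
    inferInstanceAs (((CochainComplex.singleFunctor C 0).obj X).IsStrictlyLE 0)
  obtain ⟨K, _, π, h, g, rfl⟩ := right_fac_of_isStrictlyLE φ 0
  have h' := h
  rw [isIso_Q_map_iff_quasiIso] at h'
  let j : (HomologicalComplex.single C (ComplexShape.up ℤ) 0).obj (K.X 0) ⟶ K :=
    mkHomFromSingle (𝟙 _) (by
      rintro _ rfl
      apply (K.isZero_of_isStrictlyLE 0 (0 + 1) (by simp)).eq_of_tgt)
  refine ⟨K.X 0, π.f 0 ≫ (singleObjXSelf (ComplexShape.up ℤ) 0 X).hom, aux_epi_p π, ?_⟩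
  have h1 : (HomologicalComplex.single C (ComplexShape.up ℤ) 0).map
      (π.f 0 ≫ (singleObjXSelf (ComplexShape.up ℤ) 0 X).hom) = j ≫ π := by
    apply HomologicalComplex.from_single_hom_ext
    rw [comp_f, mkHomFromSingle_f, single_map_f_self]
    simp
  have h2 : j ≫ g = 0 := by
    apply HomologicalComplex.from_single_hom_ext
    apply (L.isZero_of_isStrictlyLE n 0 hn).eq_of_tgt
  rw [h1, Functor.map_comp, Category.assoc, IsIso.hom_inv_id_assoc, ← Functor.map_comp, h2, Functor.map_zero]

theorem aux_efface {C : Type u} [Category.{v} C] [Abelian C] [HasExt.{max u v} C] {X Y : C} {n : ℕ}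
    (e : Abelian.Ext.{max u v} X Y (n + 1)) :
    ∃ (P : C) (p : P ⟶ X), Epi p ∧ (Abelian.Ext.mk₀ p).comp e (zero_add _) = 0 := by
  let := HasDerivedCategory.standard C
  obtain ⟨P, p, hp, h⟩ := aux_efface_Q (X := X) (L := (CochainComplex.singleFunctor C (-((n:ℤ) + 1))).obj Y)
    (e.hom ≫ ((singleFunctors C).shiftIso (n + 1) (-(n + 1)) 0 (by lia)).hom.app _) (-((n:ℤ)+1)) (by lia)
  refine ⟨P, p, hp, ?_⟩
  apply Abelian.Ext.homEquiv.injective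
  have h2 : ((singleFunctor C 0).map p) ≫ e.hom = 0 := by
    rw [← cancel_mono (((singleFunctors C).shiftIso (n + 1) (-(n + 1)) 0
      (by lia)).hom.app _), Category.assoc, Limits.zero_comp]
    exact h
  change (Abelian.Ext.comp _ _ _).hom = Abelian.Ext.hom 0
  rw [Abelian.Ext.comp_hom, Abelian.Ext.mk₀_hom, Abelian.Ext.zero_hom, ShiftedHom.mk₀_comp]
  exact h2
end Efface

section YonedaClass

open Abelian (Ext)

theorem aux_ses {X Y : A} (f : X ⟶ Y) [Epi f] :
    (ShortComplex.mk (kernel.ι f) f (kernel.condition f)).ShortExact where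
  exact := ShortComplex.exact_of_f_is_kernel _ (kernelIsKernel f)

/-- Dropping the last map of an extension. -/
noncomputable def ExtSeq.tailSeq {n : ℕ} {X Y : A} (s : ExtSeq A (n + 1) X Y) :
    ExtSeq A n (kernel (s.d 0)) Y where
  ob := fun
    | 0 => kernel (s.d 0)
    | i + 1 => s.ob (i + 2)
  d := fun
    | 0 => kernel.lift (s.d 0) (s.d 1) (s.w 0)
    | i + 1 => s.d (i + 2)
  iso0 := Iso.refl _
  isoTop := s.isoTop
  is_zero := by
    rintro (_ | i) hi
    · omega
    · exact s.is_zero (i + 2) (by omega)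
  w := by
    rintro (_ | i)
    · dsimp only
      ext
      simp [s.w 1]
    · exact s.w (i + 2)
  ex := by
    rintro (_ | i)
    · have h := s.ex 1
      rw [ShortComplex.exact_iff_exact_up_to_refinements] at h ⊢
      intro T x hx
      refine h x ?_
      have := hx =≫ kernel.ι (s.d 0)
      simpa using this
    · exact s.ex (i + 2)
  epi0 := (s.ex 0).epi_kernelLift

/-- Splicing a short exact sequence with an extension. -/
noncomputable def ExtSeq.splice {S : ShortComplex A} (hS : S.ShortExact) {n : ℕ} {Y : A}
    (s : ExtSeq A n S.X₁ Y) : ExtSeq A (n + 1) S.X₃ Y where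
  ob := fun
    | 0 => S.X₃
    | 1 => S.X₂
    | i + 2 => s.ob (i + 1)
  d := fun
    | 0 => S.g
    | 1 => s.d 0 ≫ s.iso0.hom ≫ S.f
    | i + 2 => s.d (i + 1)
  iso0 := Iso.refl _
  isoTop := s.isoTop
  is_zero := by
    rintro (_ | _ | i) hi
    · omega
    · omega
    · exact s.is_zero (i + 1) (by omega)
  w := by
    rintro (_ | _ | i)
    · simp
    · dsimp only
      rw [← Category.assoc, s.w 0, zero_comp]
    · exact s.w (i + 1)
  ex := by
    have := hS.mono_f
    have := s.epi0
    rintro (_ | _ | i)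
    · have h := hS.exact
      rw [ShortComplex.exact_iff_exact_up_to_refinements] at h ⊢
      intro T x hx
      obtain ⟨T', π, hπ, y, hy⟩ := h x hx
      obtain ⟨T'', π', hπ', z, hz⟩ :=
        surjective_up_to_refinements_of_epi (s.d 0 ≫ s.iso0.hom) y
      refine ⟨T'', π' ≫ π, inferInstance, z, ?_⟩
      dsimp only at hy ⊢
      rw [Category.assoc, hy, ← Category.assoc, hz]
      simp
    · have h := s.ex 0
      rw [ShortComplex.exact_iff_exact_up_to_refinements] at h ⊢
      intro T x hx
      refine h x ?_
      dsimp only at hx ⊢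
      rw [← cancel_mono (s.iso0.hom ≫ S.f), Category.assoc, zero_comp]
      exact hx
    · exact s.ex (i + 1)
  epi0 := hS.epi_g

open ZeroObject in
/-- The identity as a `0`-extension. -/
noncomputable def ExtSeq.triv (Y : A) : ExtSeq A 0 Y Y where
  ob := fun
    | 0 => Y
    | 1 => Y
    | _ + 2 => 0
  d := fun
    | 0 => 𝟙 Y
    | 1 => 0
    | _ + 2 => 0
  iso0 := Iso.refl _
  isoTop := Iso.refl _
  is_zero := by
    rintro (_ | _ | i) hi
    · omega
    · omega
    · exact isZero_zero A
  w := by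
    rintro (_ | _ | i)
    · exact zero_comp
    · exact zero_comp
    · exact zero_comp
  ex := by
    rintro (_ | _ | i)
    · rw [ShortComplex.exact_iff_mono _ rfl]
      exact inferInstanceAs (Mono (𝟙 Y))
    · exact ShortComplex.exact_of_isZero_X₂ _ (isZero_zero A)
    · exact ShortComplex.exact_of_isZero_X₂ _ (isZero_zero A)
  epi0 := inferInstanceAs (Epi (𝟙 Y))

theorem ExtSeq.isIso_d0 {X Y : A} (s : ExtSeq A 0 X Y) : IsIso (s.d 0) := by
  have := s.epi0
  have : Mono (s.d 0) := (s.ex 0).mono_g ((s.is_zero 2 (by omega)).eq_of_src _ _)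
  exact isIso_of_mono_of_epi _

variable [HasExt.{max u v} A]

/-- The class of an extension in the Ext-group. -/
noncomputable def ExtSeq.cls : ∀ {n : ℕ} {X Y : A}, ExtSeq A n X Y → Ext.{max u v} X Y n
  | 0, _, _, s =>
    haveI := s.isIso_d0
    Ext.mk₀ (s.iso0.inv ≫ inv (s.d 0) ≫ s.isoTop.hom)
  | _ + 1, _, _, s =>
    haveI := s.epi0
    (Ext.mk₀ s.iso0.inv).comp
      ((aux_ses (s.d 0)).extClass.comp (ExtSeq.cls s.tailSeq) (add_comm _ _)) (zero_add _)

theorem ExtSeq.cls_naturality {n : ℕ} : ∀ {X Y X' Y' : A} (s : ExtSeq A n X Y)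
    (t : ExtSeq A n X' Y') (φ : ∀ i, s.ob i ⟶ t.ob i)
    (_ : ∀ i, s.d i ≫ φ i = φ (i + 1) ≫ t.d i) (f : X ⟶ X') (g : Y ⟶ Y')
    (_ : φ 0 ≫ t.iso0.hom = s.iso0.hom ≫ f)
    (_ : φ (n + 1) ≫ t.isoTop.hom = s.isoTop.hom ≫ g),
    s.cls.comp (Ext.mk₀ g) (add_zero n) = (Ext.mk₀ f).comp t.cls (zero_add n) := by
  induction n with
  | zero =>
    intro X Y X' Y' s t φ comm f g h0 hT
    have := s.isIso_d0
    have := t.isIso_d0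
    simp only [ExtSeq.cls, Ext.mk₀_comp_mk₀]
    congr 1
    have c0 := comm 0
    change φ 1 ≫ t.isoTop.hom = _ at hT
    change _ = φ 1 ≫ _ at c0
    rw [Category.assoc, Category.assoc, ← hT, Iso.inv_comp_eq, IsIso.inv_comp_eq]
    have h0' : s.iso0.hom ≫ f ≫ t.iso0.inv = φ 0 := by
      rw [← Category.assoc, ← h0, Category.assoc, Iso.hom_inv_id, Category.comp_id]
    have h1 : φ 1 = s.d 0 ≫ φ 0 ≫ inv (t.d 0) := by
      rw [← Category.assoc, c0, Category.assoc, IsIso.hom_inv_id, Category.comp_id]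
    rw [h1, ← h0']
    simp only [Category.assoc]
  | succ n ih =>
    intro X Y X' Y' s t φ comm f g h0 hT
    have := s.epi0
    have := t.epi0
    let k : kernel (s.d 0) ⟶ kernel (t.d 0) := kernel.map _ _ (φ 1) (φ 0) (comm 0)
    have h1 := ih s.tailSeq t.tailSeq
      (fun | 0 => k | i + 1 => φ (i + 2))
      (by
        rintro (_ | i)
        · dsimp only [ExtSeq.tailSeq]
          rw [← cancel_mono (kernel.ι (t.d 0))]
          simpa [k] using comm 1
        · exact comm (i + 2)) k g
      (by simp [ExtSeq.tailSeq]) hT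
    let ψ : ShortComplex.mk _ _ (kernel.condition (s.d 0)) ⟶
      ShortComplex.mk _ _ (kernel.condition (t.d 0)) :=
      { τ₁ := k, τ₂ := φ 1, τ₃ := φ 0, comm₁₂ := by simp [k], comm₂₃ := (comm 0).symm }
    have h2 := ShortComplex.ShortExact.extClass_naturality (aux_ses (s.d 0)) (aux_ses (t.d 0)) ψ
    dsimp only [ψ] at h2
    have h3 : s.iso0.inv ≫ φ 0 = f ≫ t.iso0.inv := by
      rw [Iso.inv_comp_eq, ← Category.assoc, ← h0]; simp
    simp only [ExtSeq.cls]
    rw [Ext.comp_assoc_of_third_deg_zero, Ext.comp_assoc_of_third_deg_zero, h1,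
      ← Ext.comp_assoc_of_second_deg_zero, h2,
      Ext.comp_assoc (Ext.mk₀ (φ 0)) _ _ (zero_add 1) (add_comm 1 n) (by omega),
      Ext.mk₀_comp_mk₀_assoc, Ext.mk₀_comp_mk₀_assoc, h3]

theorem ExtSeq.cls_eq_of_hom {n : ℕ} {X Y : A} {s t : ExtSeq A n X Y} (h : ExtSeqHom s t) :
    s.cls = t.cls := by
  have := ExtSeq.cls_naturality s t h.φ h.comm (𝟙 _) (𝟙 _) (by simp [h.φ0]) (by simp [h.φTop])
  simpa using this

theorem ExtSeq.cls_eq_of_equiv {n : ℕ} {X Y : A} {s t : ExtSeq A n X Y} (h : YonedaEquiv s t) :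
    s.cls = t.cls := by
  induction h with
  | rel _ _ h => exact ExtSeq.cls_eq_of_hom h.some
  | refl => rfl
  | symm _ _ _ h => exact h.symm
  | trans _ _ _ _ _ h1 h2 => exact h1.trans h2

theorem ExtSeq.cls_splice {S : ShortComplex A} (hS : S.ShortExact) {n : ℕ} {Y : A}
    (s : ExtSeq A n S.X₁ Y) :
    (ExtSeq.splice hS s).cls = hS.extClass.comp s.cls (add_comm _ _) := by
  have := hS.epi_g
  let k : S.X₁ ⟶ kernel S.g := kernel.lift _ S.f S.zero
  have h1 := ExtSeq.cls_naturality s (ExtSeq.splice hS s).tailSeq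
    (fun | 0 => s.iso0.hom ≫ k | i + 1 => 𝟙 (s.ob (i + 1)))
    (by
      rintro (_ | i)
      · dsimp only [ExtSeq.tailSeq, ExtSeq.splice]
        rw [← cancel_mono (kernel.ι S.g)]
        simp [k]
      · exact (Category.comp_id _).trans (Category.id_comp _).symm) k (𝟙 _)
    (Category.comp_id _) ((Category.id_comp _).trans (Category.comp_id _).symm)
  rw [Ext.comp_mk₀_id] at h1
  let ψ : S ⟶ ShortComplex.mk _ _ (kernel.condition S.g) :=
    { τ₁ := k, τ₂ := 𝟙 _, τ₃ := 𝟙 _, comm₁₂ := by simp [k], comm₂₃ := by simp }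
  have h2 := ShortComplex.ShortExact.extClass_naturality hS (aux_ses S.g) ψ
  dsimp only [ψ] at h2
  rw [Ext.mk₀_id_comp] at h2
  rw [h1]
  conv_lhs => rw [ExtSeq.cls]
  refine (Ext.mk₀_id_comp _).trans ?_
  refine (congrArg (fun x => Ext.comp x _ _) h2.symm).trans ?_
  exact Ext.comp_assoc_of_second_deg_zero ..

theorem ExtSeq.cls_triv (Y : A) : (ExtSeq.triv Y).cls = Ext.mk₀ (𝟙 Y) := by
  have := (ExtSeq.triv Y).isIso_d0
  rw [ExtSeq.cls]
  congr 1
  have h : inv ((ExtSeq.triv Y).d 0) = 𝟙 Y := IsIso.inv_eq_of_hom_inv_id (Category.comp_id _)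
  rw [h]
  simp [ExtSeq.triv]

theorem aux_pushout_ses {S : ShortComplex A} (hS : S.ShortExact) {Y : A} (h : S.X₁ ⟶ Y) :
    (ShortComplex.mk (pushout.inr S.f h)
      (pushout.desc S.g (0 : Y ⟶ S.X₃) (by simp) : pushout S.f h ⟶ S.X₃)
      (pushout.inr_desc _ _ _)).ShortExact := by
  have := hS.mono_f
  have := hS.epi_g
  refine { exact := ?_, mono_f := ?_, epi_g := ?_ }
  · rw [ShortComplex.exact_iff_exact_up_to_refinements]
    intro T z hz
    dsimp only at z hz ⊢
    obtain ⟨T', π, _, x₂, x₃, hx⟩ :=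
      (IsPushout.of_hasPushout S.f h).hom_eq_add_up_to_refinements z
    have h1 : x₂ ≫ S.g = 0 := by
      have := hx =≫ pushout.desc S.g (0 : Y ⟶ S.X₃) (by simp)
      simpa [hz, pushout.inl_desc, pushout.inr_desc] using this.symm
    refine ⟨T', π, inferInstance, hS.exact.lift x₂ h1 ≫ h + x₃, ?_⟩
    rw [hx, Preadditive.add_comp, Category.assoc, ← pushout.condition,
      ShortComplex.Exact.lift_f_assoc]
  · dsimp only; infer_instance
  · dsimp only
    have h1 : pushout.inl S.f h ≫ pushout.desc S.g (0 : Y ⟶ S.X₃) (by simp) = S.g :=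
      pushout.inl_desc _ _ _
    exact epi_of_epi_fac h1

theorem ExtSeq.cls_surjective (n : ℕ) : ∀ {X Y : A} (e : Ext.{max u v} X Y (n + 1)),
    ∃ s : ExtSeq A (n + 1) X Y, s.cls = e := by
  induction n with
  | zero =>
    intro X Y e
    obtain ⟨P, p, _, hp⟩ := aux_efface e
    obtain ⟨x, hx⟩ := Ext.contravariant_sequence_exact₃ (aux_ses p) Y e hp (n₀ := 0) rfl
    obtain ⟨h, rfl⟩ := (Ext.mk₀_bijective _ _).2 x
    let S := ShortComplex.mk _ _ (kernel.condition p)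
    have hS : S.ShortExact := aux_ses p
    refine ⟨ExtSeq.splice (aux_pushout_ses hS h) (ExtSeq.triv Y), ?_⟩
    rw [ExtSeq.cls_splice, ExtSeq.cls_triv]
    let ψ : S ⟶ ShortComplex.mk (pushout.inr S.f h)
      (pushout.desc S.g (0 : Y ⟶ S.X₃) (by simp) : pushout S.f h ⟶ S.X₃)
      (pushout.inr_desc _ _ _) :=
      { τ₁ := h, τ₂ := pushout.inl _ _, τ₃ := 𝟙 _, comm₁₂ := pushout.condition.symm,
        comm₂₃ := (pushout.inl_desc _ _ _).trans (Category.comp_id _).symm }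
    have h2 := ShortComplex.ShortExact.extClass_naturality hS (aux_pushout_ses hS h) ψ
    dsimp only [ψ] at h2
    rw [Ext.mk₀_id_comp] at h2
    exact (Ext.comp_mk₀_id _).trans (h2.symm.trans hx)
  | succ n ih =>
    intro X Y e
    obtain ⟨P, p, _, hp⟩ := aux_efface e
    obtain ⟨x, hx⟩ := Ext.contravariant_sequence_exact₃ (aux_ses p) Y e hp (n₀ := n + 1)
      (add_comm _ _)
    obtain ⟨s, rfl⟩ := ih x
    exact ⟨ExtSeq.splice (aux_ses p) s, (ExtSeq.cls_splice (aux_ses p) s).trans hx⟩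

theorem aux_ext_zero_of_extVanish {i : ℕ} (hi : 0 < i) {X Y : A} (h : extVanish A i X Y)
    (e : Ext.{max u v} X Y i) : e = 0 := by
  obtain ⟨n, rfl⟩ : ∃ n, i = n + 1 := ⟨i - 1, by omega⟩
  obtain ⟨s, rfl⟩ := ExtSeq.cls_surjective n e
  obtain ⟨t, ht⟩ := ExtSeq.cls_surjective n (0 : Ext.{max u v} X Y (n + 1))
  rw [← ht]
  exact ExtSeq.cls_eq_of_equiv (h s t)

theorem aux_cokernel_ses {X Y : A} (f : X ⟶ Y) [Mono f] :
    (ShortComplex.mk f (cokernel.π f) (cokernel.condition f)).ShortExact where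
  exact := ShortComplex.exact_of_g_is_cokernel _ (cokernelIsCokernel f)

theorem aux_cores_vanish (𝒰 : Set A) (d : ℕ) (E : A)
    (hE : ∀ i, 0 < i → i < d → ∀ U ∈ 𝒰, extVanish A i U E) (j : ℕ) :
    ∀ (i : ℕ), 0 < i → i + j ≤ d → ∀ C ∈ coresSet A 𝒰 j, ∀ e : Ext.{max u v} C E i, e = 0 := by
  induction j with
  | zero =>
    intro i hi hij C hC e
    have hC : IsZero C := hC
    rw [← Ext.mk₀_id_comp e, hC.eq_of_src (𝟙 C) 0, Ext.mk₀_zero, Ext.zero_comp]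
  | succ j ih =>
    rintro i hi hij C ⟨V, f, hV, _, hc⟩ e
    obtain ⟨x, hx⟩ := Ext.contravariant_sequence_exact₁ (aux_cokernel_ses f) E e
      (n₁ := i + 1) (add_comm _ _) (ih (i + 1) (by omega) (by omega) _ hc _)
    rw [← hx, aux_ext_zero_of_extVanish hi (hE i hi (by omega) V hV) x, Ext.comp_zero]

end YonedaClass

/-- a right maximal `d`-rigid subcategory `𝒰` of an abelian category equals
the class of objects `E` with `Ext^i(U, E) = 0` for all `U ∈ 𝒰` and `0 < i < d`. -/
theorem right_maximal_d_rigid_eq_perp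
    (A : Type u) [Category.{v} A] [Abelian A] (d : ℕ) (hd : 1 ≤ d)
    (𝒰 : Set A)
    (hU0 : ∀ Z : A, IsZero Z → Z ∈ 𝒰)
    (hUadd : ∀ X Y : A, X ∈ 𝒰 → Y ∈ 𝒰 → (X ⊞ Y) ∈ 𝒰)
    (hUiso : ∀ X Y : A, (X ≅ Y) → X ∈ 𝒰 → Y ∈ 𝒰)
    (hrigid : ∀ i, 0 < i → i < d → ∀ U ∈ 𝒰, ∀ U' ∈ 𝒰, extVanish A i U U')
    (hsummand : ∀ (X Y : A) (r : X ⟶ Y) (ι : Y ⟶ X), ι ≫ r = 𝟙 Y → X ∈ 𝒰 → Y ∈ 𝒰)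
    (hmax : ∀ E : A, E ∈ coresSet A 𝒰 d) :
    𝒰 = {E : A | ∀ i, 0 < i → i < d → ∀ U ∈ 𝒰, extVanish A i U E} := by
  have := HasExt.standard A
  apply Set.Subset.antisymm
  · intro E hE i hi hid U hU
    exact hrigid i hi hid U hU E hE
  · intro E hE
    obtain ⟨j, rfl⟩ : ∃ j, d = j + 1 := ⟨d - 1, by omega⟩
    obtain ⟨V, f, hV, _, hc⟩ := hmax E
    obtain ⟨x, hx⟩ := Abelian.Ext.contravariant_sequence_exact₁ (aux_cokernel_ses f) E
      (Abelian.Ext.mk₀ (𝟙 E)) (n₁ := 1) rfl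
      (aux_cores_vanish 𝒰 (j + 1) E hE j 1 one_pos (by omega) _ hc _)
    obtain ⟨r, rfl⟩ := (Abelian.Ext.mk₀_bijective _ _).2 x
    rw [Abelian.Ext.mk₀_comp_mk₀] at hx
    exact hsummand V E r f ((Abelian.Ext.mk₀_bijective _ _).1 hx) hV
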